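/- Suppose the curve of metrics g(t) satisfies Assumption (A), and fix t ≥ t₀ with g = g(t) and e = e(t). Then there are constants C, depending only on the constant in Assumption (A) and not on t or the metric, such that for all covariant momenta p_* ≠ q_* in ℝ³ and unit vectors ω, ξ: |∂_{p_i}p⁰| ≤ C t^{−2/3}; |∂_{p_i}h| ≤ C q⁰ t^{−2/3}/h and |∂_{p_i}h| ≤ C (p⁰)^{1/2}(q⁰)^{3/2} t^{−2/3}; |∂_{p_i}√s| ≤ C q⁰ t^{−2/3}/√s and |∂_{p_i}√s| ≤ C (p⁰)^{1/2}(q⁰)^{3/2} t^{−2/3}; |∂_{p_i}√((n⁰)² − (n_a e^a_b ξ^b)²)| ≤ C n⁰ t^{−2/3}/√((n⁰)² − (n_a e^a_b ξ^b)²); and, for n_* ≠ 0, |∂_{p_i}[n_a e^a_b ω^b n_j/(n_c n^c)]| ≤ C/√(n_a n^a). -/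

import Mathlib

open Matrix

/-- The Cholesky factor of a symmetric positive definite `3×3` matrix `g`: the lower
triangular matrix `θ` with positive diagonal such that `g = θ * θᵀ`, given by its
explicit formula in terms of the leading principal minors of `g`. -/
noncomputable def chol (g : Matrix (Fin 3) (Fin 3) ℝ) : Matrix (Fin 3) (Fin 3) ℝ :=
  !![g 0 0 / Real.sqrt (g 0 0), 0, 0;
     g 0 1 / Real.sqrt (g 0 0),
       (g 0 0 * g 1 1 - g 0 1 ^ 2) /
         (Real.sqrt (g 0 0) * Real.sqrt (g 0 0 * g 1 1 - g 0 1 ^ 2)), 0;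
     g 0 2 / Real.sqrt (g 0 0),
       (g 0 0 * g 1 2 - g 0 1 * g 0 2) /
         (Real.sqrt (g 0 0) * Real.sqrt (g 0 0 * g 1 1 - g 0 1 ^ 2)),
       g.det / (Real.sqrt (g 0 0 * g 1 1 - g 0 1 ^ 2) * Real.sqrt g.det)]

/-- The orthonormal frame `e^a_b` obtained from the Cholesky factorization,
satisfying `g_{ab} e^a_c e^b_d = δ_{cd}`; its inverse is `θ^a_b = (chol g)ᵀ`. -/
noncomputable def frameE (g : Matrix (Fin 3) (Fin 3) ℝ) : Matrix (Fin 3) (Fin 3) ℝ :=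
  ((chol g)ᵀ)⁻¹

/-- The energy `p⁰ = √(1 + g^{ab} p_a p_b)`. -/
noncomputable def energy (g : Matrix (Fin 3) (Fin 3) ℝ) (p : Fin 3 → ℝ) : ℝ :=
  Real.sqrt (1 + p ⬝ᵥ (g⁻¹ *ᵥ p))

/-- The relative momentum `h`. -/
noncomputable def relMom (g : Matrix (Fin 3) (Fin 3) ℝ) (p q : Fin 3 → ℝ) : ℝ :=
  Real.sqrt (-(energy g p - energy g q) ^ 2 + (p - q) ⬝ᵥ (g⁻¹ *ᵥ (p - q)))

/-- The total energy `s`. -/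
noncomputable def totEnergy (g : Matrix (Fin 3) (Fin 3) ℝ) (p q : Fin 3 → ℝ) : ℝ :=
  (energy g p + energy g q) ^ 2 - (p + q) ⬝ᵥ (g⁻¹ *ᵥ (p + q))

/-- Assumption (A) on a curve of metrics `g(t)`, `t ≥ t₀ > 0`, with constant `CA` and
parameter `ε₁`: writing `g_{ab}(t) = t^{4/3}ḡ_{ab}(t)` and `g^{ab}(t) = t^{−4/3}ḡ^{ab}(t)`,
all entries satisfy `|ḡ_{ab}| ≤ CA`, `|ḡ^{ab}| ≤ CA`; the Cholesky orthonormal frame and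
its inverse satisfy `|e^a_b| ≤ CA t^{−2/3}`, `|θ^a_b| ≤ CA t^{2/3}`; and for some
`0 < ε₁ < 1/12`, `t ↦ t^{−ε₁} ḡ^{ab}(t) p_a p_b` is non-increasing for every `p`. -/
def AssumpA (t₀ CA ε₁ : ℝ) (g : ℝ → Matrix (Fin 3) (Fin 3) ℝ) : Prop :=
  (∀ t ∈ Set.Ici t₀, (g t).PosDef) ∧
  (∀ t ∈ Set.Ici t₀, ∀ a b : Fin 3,
    |t ^ (-(4 : ℝ) / 3) * g t a b| ≤ CA ∧
    |t ^ ((4 : ℝ) / 3) * (g t)⁻¹ a b| ≤ CA ∧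
    |frameE (g t) a b| ≤ CA * t ^ (-(2 : ℝ) / 3) ∧
    |(chol (g t))ᵀ a b| ≤ CA * t ^ ((2 : ℝ) / 3)) ∧
  (0 < ε₁ ∧ ε₁ < 1 / 12) ∧
  (∀ p : Fin 3 → ℝ,
    AntitoneOn (fun t => t ^ ((4 : ℝ) / 3 - ε₁) * (p ⬝ᵥ ((g t)⁻¹ *ᵥ p))) (Set.Ici t₀))

section Euclidean

variable {ι : Type*} [Fintype ι]

theorem dotProduct_self_nonneg_real (u : ι → ℝ) : 0 ≤ u ⬝ᵥ u :=
  Finset.sum_nonneg fun _ _ => mul_self_nonneg _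

theorem dotProduct_sq_le (u v : ι → ℝ) : (u ⬝ᵥ v) ^ 2 ≤ (u ⬝ᵥ u) * (v ⬝ᵥ v) := by
  simpa only [dotProduct, sq] using Finset.sum_mul_sq_le_sq_mul_sq Finset.univ u v

theorem abs_dotProduct_le {u v : ι → ℝ} {a b : ℝ} (ha : 0 ≤ a) (hb : 0 ≤ b)
    (hu : u ⬝ᵥ u ≤ a ^ 2) (hv : v ⬝ᵥ v ≤ b ^ 2) : |u ⬝ᵥ v| ≤ a * b := by
  refine abs_le_of_sq_le_sq ?_ (mul_nonneg ha hb)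
  calc (u ⬝ᵥ v) ^ 2 ≤ (u ⬝ᵥ u) * (v ⬝ᵥ v) := dotProduct_sq_le u v
    _ ≤ a ^ 2 * b ^ 2 :=
      mul_le_mul hu hv (dotProduct_self_nonneg_real v) (sq_nonneg a)
    _ = (a * b) ^ 2 := by ring

theorem HasDerivAt.dotProduct_real {u v : ℝ → ι → ℝ} {u' v' : ι → ℝ} {x : ℝ}
    (hu : HasDerivAt u u' x) (hv : HasDerivAt v v' x) :
    HasDerivAt (fun y => u y ⬝ᵥ v y) (u' ⬝ᵥ v x + u x ⬝ᵥ v') x := by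
  have h := HasDerivAt.fun_sum (u := Finset.univ) fun i _ =>
    (hasDerivAt_pi.1 hu i).mul (hasDerivAt_pi.1 hv i)
  simpa only [dotProduct, Finset.sum_add_distrib, Pi.mul_apply] using h

theorem HasDerivAt.dotProduct_self_real {u : ℝ → ι → ℝ} {u' : ι → ℝ} {x : ℝ}
    (hu : HasDerivAt u u' x) :
    HasDerivAt (fun y => u y ⬝ᵥ u y) (2 * (u x ⬝ᵥ u')) x := by
  have h := hu.dotProduct_real hu
  rwa [dotProduct_comm u', ← two_mul] at h

/-- The energy of a momentum expressed in an orthonormal frame. -/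
noncomputable def flatEnergy (P : ι → ℝ) : ℝ := Real.sqrt (1 + P ⬝ᵥ P)

theorem flatEnergy_sq (P : ι → ℝ) : flatEnergy P ^ 2 = 1 + P ⬝ᵥ P :=
  Real.sq_sqrt (by linarith [dotProduct_self_nonneg_real P])

theorem one_le_flatEnergy (P : ι → ℝ) : 1 ≤ flatEnergy P :=
  Real.one_le_sqrt.2 (by linarith [dotProduct_self_nonneg_real P])

theorem dotProduct_self_le_flatEnergy_sq (P : ι → ℝ) : P ⬝ᵥ P ≤ flatEnergy P ^ 2 := by
  linarith [flatEnergy_sq P]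

theorem hasDerivAt_flatEnergy {P : ℝ → ι → ℝ} {E : ι → ℝ} {x : ℝ} (hP : HasDerivAt P E x) :
    HasDerivAt (fun y => flatEnergy (P y)) ((P x ⬝ᵥ E) / flatEnergy (P x)) x := by
  have h := (hP.dotProduct_self_real.const_add 1).sqrt
    (by linarith [dotProduct_self_nonneg_real (P x)])
  refine HasDerivAt.congr_deriv (f := fun y => flatEnergy (P y)) h ?_
  exact mul_div_mul_left _ _ two_ne_zero

theorem abs_energy_slope_le {P E : ι → ℝ} {B : ℝ} (hB : 0 ≤ B) (hE : E ⬝ᵥ E ≤ B ^ 2) :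
    |(P ⬝ᵥ E) / flatEnergy P| ≤ B := by
  have h0 : 0 < flatEnergy P := one_pos.trans_le (one_le_flatEnergy P)
  rw [abs_div, abs_of_pos h0, div_le_iff₀ h0, mul_comm]
  exact abs_dotProduct_le h0.le hB (dotProduct_self_le_flatEnergy_sq P) hE

/-- `q⁰` times the difference of the velocities `P / p⁰` and `Q / q⁰`. -/
noncomputable def velDiff (P Q : ι → ℝ) : ι → ℝ :=
  (flatEnergy Q / flatEnergy P) • P - Q

/-- The square of the relative momentum in an orthonormal frame. -/
noncomputable def flatRel (P Q : ι → ℝ) : ℝ :=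
  -(flatEnergy P - flatEnergy Q) ^ 2 + (P - Q) ⬝ᵥ (P - Q)

/-- The total energy in an orthonormal frame. -/
noncomputable def flatTot (P Q : ι → ℝ) : ℝ :=
  (flatEnergy P + flatEnergy Q) ^ 2 - (P + Q) ⬝ᵥ (P + Q)

theorem flatRel_eq (P Q : ι → ℝ) :
    flatRel P Q = 2 * (flatEnergy P * flatEnergy Q - P ⬝ᵥ Q - 1) := by
  have hP := flatEnergy_sq P
  have hQ := flatEnergy_sq Q
  simp only [flatRel, sub_dotProduct, dotProduct_sub, dotProduct_comm Q P]
  linear_combination -hP - hQ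

theorem flatTot_eq (P Q : ι → ℝ) : flatTot P Q = flatRel P Q + 4 := by
  have hP := flatEnergy_sq P
  have hQ := flatEnergy_sq Q
  rw [flatRel_eq]
  simp only [flatTot, add_dotProduct, dotProduct_add, dotProduct_comm Q P]
  linear_combination hP + hQ

theorem velDiff_dotProduct_self (P Q : ι → ℝ) :
    velDiff P Q ⬝ᵥ velDiff P Q =
      flatEnergy Q / flatEnergy P * flatRel P Q - (1 - flatEnergy Q / flatEnergy P) ^ 2 := by
  have h0 : flatEnergy P ≠ 0 := (one_pos.trans_le (one_le_flatEnergy P)).ne'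
  have hP : P ⬝ᵥ P = flatEnergy P ^ 2 - 1 := by linarith [flatEnergy_sq P]
  have hQ : Q ⬝ᵥ Q = flatEnergy Q ^ 2 - 1 := by linarith [flatEnergy_sq Q]
  rw [flatRel_eq]
  simp only [velDiff, sub_dotProduct, dotProduct_sub, dotProduct_comm Q P, smul_dotProduct,
    dotProduct_smul, smul_eq_mul, hP, hQ]
  field_simp
  ring

theorem velDiff_dotProduct_self_le_rel (P Q : ι → ℝ) :
    velDiff P Q ⬝ᵥ velDiff P Q ≤ flatEnergy Q / flatEnergy P * flatRel P Q := by
  rw [velDiff_dotProduct_self]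
  linarith [sq_nonneg (1 - flatEnergy Q / flatEnergy P)]

theorem flatRel_nonneg (P Q : ι → ℝ) : 0 ≤ flatRel P Q := by
  have hr : 0 < flatEnergy Q / flatEnergy P :=
    div_pos (one_pos.trans_le (one_le_flatEnergy Q)) (one_pos.trans_le (one_le_flatEnergy P))
  exact nonneg_of_mul_nonneg_right
    ((dotProduct_self_nonneg_real _).trans (velDiff_dotProduct_self_le_rel P Q)) hr

theorem flatRel_pos {P Q : ι → ℝ} (hPQ : P ≠ Q) : 0 < flatRel P Q := by
  refine (flatRel_nonneg P Q).lt_of_ne' fun h => hPQ ?_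
  have hD := velDiff_dotProduct_self P Q
  rw [h, mul_zero, zero_sub] at hD
  have hnn := dotProduct_self_nonneg_real (velDiff P Q)
  have hr : 1 - flatEnergy Q / flatEnergy P = 0 := by
    have := sq_nonneg (1 - flatEnergy Q / flatEnergy P)
    exact pow_eq_zero_iff two_ne_zero |>.1 (by linarith)
  rw [hr] at hD
  have hD0 : velDiff P Q = 0 := dotProduct_self_eq_zero.1 (by simpa using hD)
  have hone : flatEnergy Q / flatEnergy P = 1 := by linarith
  rw [velDiff, hone, one_smul] at hD0
  exact sub_eq_zero.1 hD0

theorem velDiff_dotProduct_self_le (P Q : ι → ℝ) :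
    velDiff P Q ⬝ᵥ velDiff P Q ≤ (2 * flatEnergy Q) ^ 2 := by
  have hp := one_pos.trans_le (one_le_flatEnergy P)
  have hq := one_pos.trans_le (one_le_flatEnergy Q)
  have hPQ := abs_dotProduct_le hp.le hq.le (dotProduct_self_le_flatEnergy_sq P)
    (dotProduct_self_le_flatEnergy_sq Q)
  have hle : flatRel P Q ≤ 4 * (flatEnergy P * flatEnergy Q) := by
    rw [flatRel_eq]
    linarith [neg_abs_le (P ⬝ᵥ Q)]
  calc velDiff P Q ⬝ᵥ velDiff P Q
      ≤ flatEnergy Q / flatEnergy P * flatRel P Q := velDiff_dotProduct_self_le_rel P Q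
    _ ≤ flatEnergy Q / flatEnergy P * (4 * (flatEnergy P * flatEnergy Q)) := by gcongr
    _ = (2 * flatEnergy Q) ^ 2 := by field_simp; ring

theorem hasDerivAt_flatRel {P : ℝ → ι → ℝ} {E : ι → ℝ} {x : ℝ} (hP : HasDerivAt P E x)
    (Q : ι → ℝ) :
    HasDerivAt (fun y => flatRel (P y) Q) (2 * (velDiff (P x) Q ⬝ᵥ E)) x := by
  have h0 : flatEnergy (P x) ≠ 0 := (one_pos.trans_le (one_le_flatEnergy _)).ne'
  have h := ((((hasDerivAt_flatEnergy hP).mul_const (flatEnergy Q)).fun_sub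
    (hP.dotProduct_real (hasDerivAt_const x Q))).sub_const 1).const_mul 2
  rw [show (fun y => flatRel (P y) Q) = _ from funext fun y => flatRel_eq (P y) Q]
  refine h.congr_deriv ?_
  simp only [velDiff, sub_dotProduct, smul_dotProduct, smul_eq_mul, dotProduct_comm E Q,
    dotProduct_zero]
  field_simp
  ring

theorem abs_slope_div_sqrt_le_energy {P Q E : ι → ℝ} {B S : ℝ} (hB : 0 ≤ B)
    (hE : E ⬝ᵥ E ≤ B ^ 2) :
    |2 * (velDiff P Q ⬝ᵥ E) / (2 * Real.sqrt S)| ≤ 2 * flatEnergy Q * B / Real.sqrt S := by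
  have hq := one_pos.trans_le (one_le_flatEnergy Q)
  rw [mul_div_mul_left _ _ two_ne_zero, abs_div, abs_of_nonneg (Real.sqrt_nonneg S)]
  gcongr
  exact abs_dotProduct_le (by positivity) hB (velDiff_dotProduct_self_le P Q) hE

theorem abs_slope_div_sqrt_le_energies {P Q E : ι → ℝ} {B S : ℝ} (hB : 0 ≤ B)
    (hE : E ⬝ᵥ E ≤ B ^ 2) (hS : 0 < S) (hle : flatRel P Q ≤ S) :
    |2 * (velDiff P Q ⬝ᵥ E) / (2 * Real.sqrt S)| ≤
      Real.sqrt (flatEnergy P) * (flatEnergy Q * Real.sqrt (flatEnergy Q)) * B := by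
  have hp1 := one_le_flatEnergy P
  have hq1 := one_le_flatEnergy Q
  have hp := one_pos.trans_le hp1
  have hq := one_pos.trans_le hq1
  have hs := Real.sqrt_pos.2 hS
  rw [mul_div_mul_left _ _ two_ne_zero, abs_div, abs_of_pos hs, div_le_iff₀ hs, mul_right_comm]
  refine abs_dotProduct_le (by positivity) hB ?_ hE
  calc velDiff P Q ⬝ᵥ velDiff P Q
      ≤ flatEnergy Q / flatEnergy P * flatRel P Q := velDiff_dotProduct_self_le_rel P Q
    _ ≤ flatEnergy Q / 1 * S := by gcongr; exact flatRel_nonneg P Q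
    _ = 1 * (1 ^ 2 * flatEnergy Q) * S := by ring
    _ ≤ flatEnergy P * (flatEnergy Q ^ 2 * flatEnergy Q) * S := by gcongr
    _ = _ := by
      rw [mul_pow, mul_pow, mul_pow, Real.sq_sqrt hp.le, Real.sq_sqrt hq.le, Real.sq_sqrt hS.le]

theorem hasDerivAt_sqrt_flatRel {P : ℝ → ι → ℝ} {E Q : ι → ℝ} {x : ℝ}
    (hP : HasDerivAt P E x) (hPQ : P x ≠ Q) :
    HasDerivAt (fun y => Real.sqrt (flatRel (P y) Q))
      (2 * (velDiff (P x) Q ⬝ᵥ E) / (2 * Real.sqrt (flatRel (P x) Q))) x :=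
  (hasDerivAt_flatRel hP Q).sqrt (flatRel_pos hPQ).ne'

theorem flatTot_pos (P Q : ι → ℝ) : 0 < flatTot P Q := by
  rw [flatTot_eq]
  linarith [flatRel_nonneg P Q]

theorem hasDerivAt_sqrt_flatTot {P : ℝ → ι → ℝ} {E : ι → ℝ} {x : ℝ}
    (hP : HasDerivAt P E x) (Q : ι → ℝ) :
    HasDerivAt (fun y => Real.sqrt (flatTot (P y) Q))
      (2 * (velDiff (P x) Q ⬝ᵥ E) / (2 * Real.sqrt (flatTot (P x) Q))) x := by
  have h : HasDerivAt (fun y => flatTot (P y) Q) (2 * (velDiff (P x) Q ⬝ᵥ E)) x := by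
    simpa only [flatTot_eq] using (hasDerivAt_flatRel hP Q).add_const 4
  exact h.sqrt (flatTot_pos _ _).ne'

theorem abs_deriv_sqrt_transverse_le {P : ℝ → ι → ℝ} {E Q ξ : ι → ℝ} {x B : ℝ}
    (hP : HasDerivAt P E x) (hB : 0 ≤ B) (hE : E ⬝ᵥ E ≤ B ^ 2) (hξ : ξ ⬝ᵥ ξ = 1) :
    |deriv (fun y => Real.sqrt
        ((flatEnergy (P y) + flatEnergy Q) ^ 2 - ((P y + Q) ⬝ᵥ ξ) ^ 2)) x| ≤
      2 * (flatEnergy (P x) + flatEnergy Q) * B /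
        Real.sqrt ((flatEnergy (P x) + flatEnergy Q) ^ 2 - ((P x + Q) ⬝ᵥ ξ) ^ 2) := by
  set n := flatEnergy (P x) + flatEnergy Q with hn
  have hn0 : 0 < n := by linarith [one_le_flatEnergy (P x), one_le_flatEnergy Q]
  have htot := flatTot_pos (P x) Q
  have hN : (P x + Q) ⬝ᵥ (P x + Q) < n ^ 2 := by
    rw [flatTot] at htot
    linarith
  have hF : 0 < n ^ 2 - ((P x + Q) ⬝ᵥ ξ) ^ 2 := by
    have h := dotProduct_sq_le (P x + Q) ξ
    rw [hξ, mul_one] at h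
    linarith
  have hlin := (hP.add_const Q).dotProduct_real (hasDerivAt_const x ξ)
  have hd := ((((hasDerivAt_flatEnergy hP).add_const (flatEnergy Q)).fun_pow 2).fun_sub
    (hlin.fun_pow 2)).sqrt hF.ne'
  have hs := Real.sqrt_pos.2 hF
  rw [hd.deriv, ← hn, abs_div, abs_of_pos (mul_pos two_pos hs),
    div_le_div_iff₀ (mul_pos two_pos hs) hs]
  have h1 := abs_energy_slope_le (P := P x) hB hE
  have h2 := abs_dotProduct_le hn0.le zero_le_one hN.le (by rw [hξ, one_pow])
  have h3 := abs_dotProduct_le hB zero_le_one hE (by rw [hξ, one_pow])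
  rw [mul_one] at h2 h3
  have hmul : |2 * n * (P x ⬝ᵥ E / flatEnergy (P x)) - 2 * ((P x + Q) ⬝ᵥ ξ) * (E ⬝ᵥ ξ)| ≤
      2 * n * B + 2 * n * B := by
    refine (abs_sub _ _).trans (add_le_add ?_ ?_)
    · rw [abs_mul, abs_of_pos (by positivity : 0 < 2 * n)]
      gcongr
    · rw [abs_mul, abs_mul, abs_two]
      gcongr
  simp only [Nat.cast_ofNat, dotProduct_zero, add_zero, Nat.add_one_sub_one, pow_one]
  calc _ ≤ (2 * n * B + 2 * n * B) *
        Real.sqrt (n ^ 2 - ((P x + Q) ⬝ᵥ ξ) ^ 2) := by gcongr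
    _ = _ := by ring

theorem abs_deriv_direction_ratio_le {N : ℝ → ι → ℝ} {E ω : ι → ℝ} {m : ℝ → ℝ}
    {x m' B K : ℝ} (hN : HasDerivAt N E x) (hm : HasDerivAt m m' x) (hm' : |m'| ≤ 1)
    (hB : 0 ≤ B) (hE : E ⬝ᵥ E ≤ B ^ 2) (hω : ω ⬝ᵥ ω = 1) (hK : 0 ≤ K)
    (hmK : |m x| ≤ K * Real.sqrt (N x ⬝ᵥ N x)) (hN0 : N x ≠ 0) :
    |deriv (fun y => (N y ⬝ᵥ ω) * m y / (N y ⬝ᵥ N y)) x| ≤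
      (3 * (B * K) + 1) / Real.sqrt (N x ⬝ᵥ N x) := by
  have hr0 : 0 < N x ⬝ᵥ N x :=
    (dotProduct_self_nonneg_real _).lt_of_ne' (dotProduct_self_eq_zero.not.2 hN0)
  have hd := ((hN.dotProduct_real (hasDerivAt_const x ω)).fun_mul hm).fun_div
    hN.dotProduct_self_real hr0.ne'
  set r := Real.sqrt (N x ⬝ᵥ N x) with hr
  have hrpos : 0 < r := Real.sqrt_pos.2 hr0
  have hrsq : N x ⬝ᵥ N x = r ^ 2 := (Real.sq_sqrt hr0.le).symm
  rw [hd.deriv, hrsq, dotProduct_zero, add_zero]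
  have hω' : ω ⬝ᵥ ω ≤ 1 ^ 2 := by rw [hω, one_pow]
  have h1 := abs_dotProduct_le hB zero_le_one hE hω'
  have h2 := abs_dotProduct_le hrpos.le zero_le_one hrsq.le hω'
  have h3 := abs_dotProduct_le hrpos.le hB hrsq.le hE
  rw [mul_one] at h1 h2
  rw [abs_div, abs_of_pos (by positivity : 0 < (r ^ 2) ^ 2),
    div_le_div_iff₀ (by positivity) hrpos]
  have hmain : |((E ⬝ᵥ ω) * m x + (N x ⬝ᵥ ω) * m') * r ^ 2 -
      (N x ⬝ᵥ ω) * m x * (2 * (N x ⬝ᵥ E))| ≤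
      (B * (K * r) + r * 1) * r ^ 2 + r * (K * r) * (2 * (r * B)) := by
    refine (abs_sub _ _).trans (add_le_add ?_ ?_)
    · rw [abs_mul, abs_of_pos (by positivity : 0 < r ^ 2)]
      gcongr
      refine (abs_add_le _ _).trans (add_le_add ?_ ?_) <;> rw [abs_mul] <;> gcongr
    · rw [abs_mul, abs_mul, abs_mul, abs_two]
      gcongr
  calc _ ≤ ((B * (K * r) + r * 1) * r ^ 2 + r * (K * r) * (2 * (r * B))) * r := by gcongr
    _ = _ := by ring

end Euclidean

section Cholesky

variable {g : Matrix (Fin 3) (Fin 3) ℝ}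

theorem chol_mul_transpose (hg : g.PosDef) : chol g * (chol g)ᵀ = g := by
  have hsymm : ∀ a b, g a b = g b a := fun a b => by
    simpa using (hg.isHermitian.apply a b).symm
  have hquad : ∀ v : Fin 3 → ℝ, v ≠ 0 → 0 < v ⬝ᵥ (g *ᵥ v) := fun v hv => by
    simpa using hg.dotProduct_mulVec_pos hv
  have ha : 0 < g 0 0 := hg.diag_pos
  have hm : 0 < g 0 0 * g 1 1 - g 0 1 ^ 2 := by
    have h := hquad ![g 0 1, -g 0 0, 0] fun h0 => by
      have := congrFun h0 1
      simp [ha.ne'] at this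
    simp only [dotProduct, mulVec, Fin.sum_univ_three, hsymm 1 0] at h
    simp at h
    refine pos_of_mul_pos_right (a := g 0 0) ?_ ha.le
    linarith
  have hdet : 0 < g.det := hg.det_pos
  have hdet' := det_fin_three g
  rw [hsymm 1 0, hsymm 2 0, hsymm 2 1] at hdet'
  have hsa : Real.sqrt (g 0 0) ≠ 0 := (Real.sqrt_pos.2 ha).ne'
  have hsm := (Real.sqrt_pos.2 hm).ne'
  have hsd := (Real.sqrt_pos.2 hdet).ne'
  have ea := Real.sq_sqrt ha.le
  have em := Real.sq_sqrt hm.le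
  have ed := Real.sq_sqrt hdet.le
  rw [chol]
  generalize Real.sqrt (g 0 0) = a at *
  generalize Real.sqrt (g 0 0 * g 1 1 - g 0 1 ^ 2) = m at *
  generalize Real.sqrt g.det = d at *
  rw [← em, ← ed, ← ea]
  rw [← ea] at em hdet'
  ext i j
  fin_cases i <;> fin_cases j <;>
    simp [mul_apply, Fin.sum_univ_three, hsymm 1 0, hsymm 2 0, hsymm 2 1] <;> field_simp
  · exact ea
  · linear_combination em
  · ring
  · ring
  · linear_combination (g 0 2 ^ 2 - a ^ 2 * g 2 2) * em + a ^ 2 * ed + a ^ 2 * hdet'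

theorem isUnit_det_chol (hg : g.PosDef) : IsUnit (chol g).det := by
  have h := congrArg det (chol_mul_transpose hg)
  rw [det_mul, det_transpose] at h
  exact isUnit_iff_ne_zero.2 fun h0 => hg.det_pos.ne' (by rw [← h, h0, zero_mul])

theorem frameE_transpose : (frameE g)ᵀ = (chol g)⁻¹ := by
  rw [frameE, transpose_nonsing_inv, transpose_transpose]

theorem frameE_mul_transpose (hg : g.PosDef) : frameE g * (frameE g)ᵀ = g⁻¹ := by
  rw [frameE_transpose, frameE, ← Matrix.mul_inv_rev, chol_mul_transpose hg]

theorem chol_mulVec_frameE_transpose (hg : g.PosDef) (p : Fin 3 → ℝ) :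
    chol g *ᵥ ((frameE g)ᵀ *ᵥ p) = p := by
  rw [frameE_transpose, mulVec_mulVec, mul_nonsing_inv _ (isUnit_det_chol hg), one_mulVec]

theorem frameE_transpose_mulVec_injective (hg : g.PosDef) :
    Function.Injective ((frameE g)ᵀ *ᵥ ·) :=
  Function.LeftInverse.injective (g := (chol g *ᵥ ·)) (chol_mulVec_frameE_transpose hg)

theorem dotProduct_frameE_mulVec (p ξ : Fin 3 → ℝ) :
    p ⬝ᵥ (frameE g *ᵥ ξ) = ((frameE g)ᵀ *ᵥ p) ⬝ᵥ ξ := by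
  rw [dotProduct_mulVec, mulVec_transpose]

theorem dotProduct_inv_mulVec_self (hg : g.PosDef) (p : Fin 3 → ℝ) :
    p ⬝ᵥ (g⁻¹ *ᵥ p) = ((frameE g)ᵀ *ᵥ p) ⬝ᵥ ((frameE g)ᵀ *ᵥ p) := by
  rw [← frameE_mul_transpose hg, ← mulVec_mulVec, dotProduct_frameE_mulVec]

theorem energy_eq_flatEnergy (hg : g.PosDef) (p : Fin 3 → ℝ) :
    energy g p = flatEnergy ((frameE g)ᵀ *ᵥ p) := by
  rw [energy, flatEnergy, dotProduct_inv_mulVec_self hg]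

theorem relMom_eq_sqrt_flatRel (hg : g.PosDef) (p q : Fin 3 → ℝ) :
    relMom g p q = Real.sqrt (flatRel ((frameE g)ᵀ *ᵥ p) ((frameE g)ᵀ *ᵥ q)) := by
  rw [relMom, flatRel, dotProduct_inv_mulVec_self hg, energy_eq_flatEnergy hg,
    energy_eq_flatEnergy hg, mulVec_sub]

theorem totEnergy_eq_flatTot (hg : g.PosDef) (p q : Fin 3 → ℝ) :
    totEnergy g p q = flatTot ((frameE g)ᵀ *ᵥ p) ((frameE g)ᵀ *ᵥ q) := by
  rw [totEnergy, flatTot, dotProduct_inv_mulVec_self hg, energy_eq_flatEnergy hg,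
    energy_eq_flatEnergy hg, mulVec_add]

theorem hasDerivAt_mulVec_update (A : Matrix (Fin 3) (Fin 3) ℝ) (p : Fin 3 → ℝ) (i : Fin 3) :
    HasDerivAt (fun x => Aᵀ *ᵥ Function.update p i x) (A i) (p i) := by
  have h := (mulVecLin Aᵀ).toContinuousLinearMap.hasFDerivAt.comp_hasDerivAt (p i)
    (hasDerivAt_update p i (p i))
  refine HasDerivAt.congr_deriv (f := fun x => Aᵀ *ᵥ Function.update p i x) h ?_
  ext k
  simp

theorem dotProduct_self_le_of_abs_le {v : Fin 3 → ℝ} {c : ℝ} (h : ∀ k, |v k| ≤ c) :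
    v ⬝ᵥ v ≤ (2 * c) ^ 2 := by
  have hsq : ∀ k, v k * v k ≤ c ^ 2 := fun k => by
    rw [← sq]
    exact sq_le_sq' (abs_le.1 (h k)).1 (abs_le.1 (h k)).2
  rw [dotProduct, Fin.sum_univ_three]
  linarith [hsq 0, hsq 1, hsq 2, sq_nonneg c]

end Cholesky

/-- Under Assumption (A) the partial derivatives (in `p_i`) of `p⁰`, `h`, `√s`,
`√((n⁰)² − (n_ae^a_bξ^b)²)` and of `n_ae^a_bω^bn_j/(n_cn^c)` obey the stated bounds,
with constants depending only on the constants of Assumption (A) and not on `t` or the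
metric. -/
theorem stmt_12 (t₀ CA ε₁ : ℝ) (ht₀ : 0 < t₀) (hCA : 0 < CA) :
    ∃ C > 0, ∀ g : ℝ → Matrix (Fin 3) (Fin 3) ℝ, AssumpA t₀ CA ε₁ g →
      ∀ t ∈ Set.Ici t₀, ∀ p q : Fin 3 → ℝ, p ≠ q →
      ∀ ω ξ : Fin 3 → ℝ, ω ⬝ᵥ ω = 1 → ξ ⬝ᵥ ξ = 1 → ∀ i j : Fin 3,
      -- |∂_{p_i} p⁰| ≤ C t^{−2/3}
      |deriv (fun x => energy (g t) (Function.update p i x)) (p i)|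
        ≤ C * t ^ (-(2 : ℝ) / 3) ∧
      -- |∂_{p_i} h| ≤ C q⁰ t^{−2/3} / h
      |deriv (fun x => relMom (g t) (Function.update p i x) q) (p i)|
        ≤ C * energy (g t) q * t ^ (-(2 : ℝ) / 3) / relMom (g t) p q ∧
      -- |∂_{p_i} h| ≤ C (p⁰)^{1/2} (q⁰)^{3/2} t^{−2/3}
      |deriv (fun x => relMom (g t) (Function.update p i x) q) (p i)|
        ≤ C * Real.sqrt (energy (g t) p) *
            (energy (g t) q * Real.sqrt (energy (g t) q)) * t ^ (-(2 : ℝ) / 3) ∧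
      -- |∂_{p_i} √s| ≤ C q⁰ t^{−2/3} / √s
      |deriv (fun x => Real.sqrt (totEnergy (g t) (Function.update p i x) q)) (p i)|
        ≤ C * energy (g t) q * t ^ (-(2 : ℝ) / 3) / Real.sqrt (totEnergy (g t) p q) ∧
      -- |∂_{p_i} √s| ≤ C (p⁰)^{1/2} (q⁰)^{3/2} t^{−2/3}
      |deriv (fun x => Real.sqrt (totEnergy (g t) (Function.update p i x) q)) (p i)|
        ≤ C * Real.sqrt (energy (g t) p) *
            (energy (g t) q * Real.sqrt (energy (g t) q)) * t ^ (-(2 : ℝ) / 3) ∧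
      -- |∂_{p_i} √((n⁰)² − (n_ae^a_bξ^b)²)| ≤ C n⁰ t^{−2/3} / √((n⁰)² − (n_ae^a_bξ^b)²)
      |deriv (fun x =>
          Real.sqrt ((energy (g t) (Function.update p i x) + energy (g t) q) ^ 2 -
            ((Function.update p i x + q) ⬝ᵥ (frameE (g t) *ᵥ ξ)) ^ 2)) (p i)|
        ≤ C * (energy (g t) p + energy (g t) q) * t ^ (-(2 : ℝ) / 3) /
            Real.sqrt ((energy (g t) p + energy (g t) q) ^ 2 -
              ((p + q) ⬝ᵥ (frameE (g t) *ᵥ ξ)) ^ 2) ∧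
      -- for n ≠ 0 : |∂_{p_i}[n_ae^a_bω^bn_j/(n_cn^c)]| ≤ C / √(n_an^a)
      (p + q ≠ 0 →
        |deriv (fun x =>
            ((Function.update p i x + q) ⬝ᵥ (frameE (g t) *ᵥ ω)) *
              (Function.update p i x j + q j) /
              ((Function.update p i x + q) ⬝ᵥ
                ((g t)⁻¹ *ᵥ (Function.update p i x + q)))) (p i)|
          ≤ C / Real.sqrt ((p + q) ⬝ᵥ ((g t)⁻¹ *ᵥ (p + q)))) := by
  refine ⟨12 * CA ^ 2 + 1 + 4 * CA, by positivity, ?_⟩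
  rintro g ⟨hpos, hbd, -, -⟩ t ht p q hpq ω ξ hω hξ i j
  have htpos : 0 < t := ht₀.trans_le ht
  have hg := hpos t ht
  set τ := t ^ (-(2 : ℝ) / 3) with hτ
  have hτ0 : 0 ≤ τ := (Real.rpow_pos_of_pos htpos _).le
  have hτσ : τ * t ^ ((2 : ℝ) / 3) = 1 := by
    rw [hτ, ← Real.rpow_add htpos]
    norm_num
  set σ := t ^ ((2 : ℝ) / 3)
  have hσ0 : 0 ≤ σ := (Real.rpow_pos_of_pos htpos _).le
  have hB0 : 0 ≤ 2 * (CA * τ) := by positivity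
  have hE : frameE (g t) i ⬝ᵥ frameE (g t) i ≤ (2 * (CA * τ)) ^ 2 :=
    dotProduct_self_le_of_abs_le fun k => (hbd t ht i k).2.2.1
  have hθ : chol (g t) j ⬝ᵥ chol (g t) j ≤ (2 * (CA * σ)) ^ 2 :=
    dotProduct_self_le_of_abs_le fun k => (hbd t ht k j).2.2.2
  have hP := hasDerivAt_mulVec_update (frameE (g t)) p i
  have hpx : Function.update p i (p i) = p := Function.update_eq_self i p
  have hne : (frameE (g t))ᵀ *ᵥ p ≠ (frameE (g t))ᵀ *ᵥ q :=
    (frameE_transpose_mulVec_injective hg).ne hpq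
  have hq := one_pos.trans_le (one_le_flatEnergy ((frameE (g t))ᵀ *ᵥ q))
  have hp := one_pos.trans_le (one_le_flatEnergy ((frameE (g t))ᵀ *ᵥ p))
  have hC1 : 2 * CA ≤ 12 * CA ^ 2 + 1 + 4 * CA := by linarith [sq_nonneg CA]
  have hC2 : 4 * CA ≤ 12 * CA ^ 2 + 1 + 4 * CA := by linarith [sq_nonneg CA]
  simp only [energy_eq_flatEnergy hg, relMom_eq_sqrt_flatRel hg, totEnergy_eq_flatTot hg,
    dotProduct_frameE_mulVec, dotProduct_inv_mulVec_self hg]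
  have hderiv_rel := hasDerivAt_sqrt_flatRel (Q := (frameE (g t))ᵀ *ᵥ q) hP (by rwa [hpx])
  have hderiv_tot := hasDerivAt_sqrt_flatTot hP ((frameE (g t))ᵀ *ᵥ q)
  have hderiv_energy := hasDerivAt_flatEnergy hP
  rw [hpx] at hderiv_rel hderiv_tot hderiv_energy
  rw [hderiv_rel.deriv, hderiv_tot.deriv, hderiv_energy.deriv]
  refine ⟨?_, ?_, ?_, ?_, ?_, ?_, fun hnz => ?_⟩
  · refine (abs_energy_slope_le hB0 hE).trans ?_
    rw [← mul_assoc]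
    gcongr
  · refine (abs_slope_div_sqrt_le_energy hB0 hE).trans ?_
    gcongr ?_ / _
    calc _ = 4 * CA * flatEnergy ((frameE (g t))ᵀ *ᵥ q) * τ := by ring
      _ ≤ _ := by gcongr
  · refine (abs_slope_div_sqrt_le_energies hB0 hE (flatRel_pos hne) le_rfl).trans ?_
    calc _ = 2 * CA * √(flatEnergy ((frameE (g t))ᵀ *ᵥ p)) *
          (flatEnergy ((frameE (g t))ᵀ *ᵥ q) * √(flatEnergy ((frameE (g t))ᵀ *ᵥ q))) * τ := by
          ring
      _ ≤ _ := by gcongr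
  · refine (abs_slope_div_sqrt_le_energy hB0 hE).trans ?_
    gcongr ?_ / _
    calc _ = 4 * CA * flatEnergy ((frameE (g t))ᵀ *ᵥ q) * τ := by ring
      _ ≤ _ := by gcongr
  · refine (abs_slope_div_sqrt_le_energies hB0 hE (flatTot_pos _ _) ?_).trans ?_
    · rw [flatTot_eq]
      linarith
    calc _ = 2 * CA * √(flatEnergy ((frameE (g t))ᵀ *ᵥ p)) *
          (flatEnergy ((frameE (g t))ᵀ *ᵥ q) * √(flatEnergy ((frameE (g t))ᵀ *ᵥ q))) * τ := by
          ring
      _ ≤ _ := by gcongr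
  · have h := abs_deriv_sqrt_transverse_le (Q := (frameE (g t))ᵀ *ᵥ q) hP hB0 hE hξ
    rw [hpx] at h
    simp only [mulVec_add]
    refine h.trans ?_
    gcongr ?_ / _
    calc _ = 4 * CA * (flatEnergy ((frameE (g t))ᵀ *ᵥ p) +
          flatEnergy ((frameE (g t))ᵀ *ᵥ q)) * τ := by ring
      _ ≤ _ := by gcongr
  · have hN : HasDerivAt (fun x => (frameE (g t))ᵀ *ᵥ (Function.update p i x + q))
        (frameE (g t) i) (p i) := by
      simpa only [mulVec_add] using hP.add_const ((frameE (g t))ᵀ *ᵥ q)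
    have hm := (hasDerivAt_pi.1 (hasDerivAt_update p i (p i)) j).add_const (q j)
    have hm' : |(Pi.single i (1 : ℝ) : Fin 3 → ℝ) j| ≤ 1 := by
      rw [Pi.single_apply]
      split_ifs <;> simp
    have hmK : |p j + q j| ≤ 2 * (CA * σ) *
        √(((frameE (g t))ᵀ *ᵥ (p + q)) ⬝ᵥ ((frameE (g t))ᵀ *ᵥ (p + q))) := by
      have hj : p j + q j = chol (g t) j ⬝ᵥ ((frameE (g t))ᵀ *ᵥ (p + q)) :=
        (congrFun (chol_mulVec_frameE_transpose hg (p + q)) j).symm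
      rw [hj]
      exact abs_dotProduct_le (by positivity) (Real.sqrt_nonneg _) hθ
        (Real.sq_sqrt (dotProduct_self_nonneg_real _)).ge
    have hN0 : (frameE (g t))ᵀ *ᵥ (p + q) ≠ 0 := fun h0 =>
      hnz (frameE_transpose_mulVec_injective hg (by simpa using h0))
    have h := abs_deriv_direction_ratio_le hN hm hm' hB0 hE hω
      (by positivity : 0 ≤ 2 * (CA * σ)) (by rwa [hpx]) (by rwa [hpx])
    rw [hpx] at h
    refine h.trans ?_
    gcongr ?_ / _
    calc 3 * (2 * (CA * τ) * (2 * (CA * σ))) + 1 = 12 * CA ^ 2 * (τ * σ) + 1 := by ring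
      _ ≤ _ := by
        rw [hτσ]
        linarith
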